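/- arXiv:1410.3559 — 3 statements merged into one kernel-verified Lean document; each statement's English description precedes it below -/
import Mathlib

section
/- Let E and F be complex Hilbert spaces and let T be a densely defined, closed unbounded operator from E to F. Then the following are equivalent: (i) the range R(T) is a closed subset of F; (ii) there exists a constant C > 0 such that ‖u‖ ≤ C‖Tu‖ for every u in the domain D(T) of T that is orthogonal to every element of the kernel N(T); (iii) there exists a constant C > 0 such that ‖v‖ ≤ C‖T*v‖ for every v in the domain D(T*) of the Hilbert-space adjoint T* that is orthogonal to every element of the kernel N(T*). -/
/-- The norm of `u` is controlled by that of `T u` on the orthogonal complement of the kernel. -/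
def LinearPMap.IsBoundedBelowOffKer {E F : Type*}
    [NormedAddCommGroup E] [InnerProductSpace ℂ E]
    [NormedAddCommGroup F] [InnerProductSpace ℂ F] (T : E →ₗ.[ℂ] F) : Prop :=
  ∃ C > 0, ∀ u : T.domain,
    (∀ w : T.domain, T w = 0 → @inner ℂ _ _ (u : E) (w : E) = 0) → ‖(u : E)‖ ≤ C * ‖T u‖

section ClosedRange

variable {E F : Type*} [NormedAddCommGroup E] [InnerProductSpace ℂ E] [CompleteSpace E]
  [NormedAddCommGroup F] [InnerProductSpace ℂ F]

namespace LinearPMap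

variable {T : E →ₗ.[ℂ] F}

/-- Every value of a closed operator is attained on the orthogonal complement of its kernel. -/
theorem IsClosed.exists_orthogonal_preimage (hclosed : T.IsClosed) (u : T.domain) :
    ∃ u' : T.domain, T u' = T u ∧
      ∀ w : T.domain, T w = 0 → @inner ℂ _ _ (u' : E) (w : E) = 0 := by
  let N : Submodule ℂ E := T.graph.comap (LinearMap.inl ℂ E F)
  have hN : _root_.IsClosed (N : Set E) :=
    _root_.IsClosed.preimage (f := fun x : E => (x, (0 : F))) (by fun_prop) hclosed
  have : CompleteSpace N := hN.completeSpace_coe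
  obtain ⟨n, hn, m, hm, hnm⟩ := N.exists_add_mem_mem_orthogonal (u : E)
  obtain ⟨n', rfl, hn'⟩ := (mem_graph_iff T).1 (show (n, (0 : F)) ∈ T.graph from hn)
  refine ⟨u - n', by rw [map_sub, hn']; exact sub_zero _, fun w hw => ?_⟩
  have hwN : (w : E) ∈ N := (mem_graph_iff T).2 ⟨w, rfl, hw⟩
  have : ((u - n' : T.domain) : E) = m := by
    rw [Submodule.coe_sub, hnm, add_sub_cancel_left]
  rw [this]
  exact (Submodule.mem_orthogonal' _ _).1 hm _ hwN

end LinearPMap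

variable [CompleteSpace F]

/-- A closed subspace of a product of Hilbert spaces equals its double adjoint. -/
theorem Submodule.adjoint_adjoint_of_isClosed (g : Submodule ℂ (E × F))
    (hg : IsClosed (g : Set (E × F))) : g.adjoint.adjoint = g := by
  refine le_antisymm (fun x hx => ?_) (fun x hx => ?_)
  · let g' : Submodule ℂ (WithLp 2 (E × F)) :=
      g.comap (WithLp.linearEquiv 2 ℂ (E × F)).toLinearMap
    have hg' : IsClosed (g' : Set (WithLp 2 (E × F))) :=
      hg.preimage (WithLp.prod_continuous_ofLp 2 E F)
    have : CompleteSpace g' := hg'.completeSpace_coe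
    suffices h : WithLp.toLp 2 x ∈ g'ᗮᗮ by
      rw [Submodule.orthogonal_orthogonal] at h
      exact h
    rw [Submodule.mem_orthogonal]
    intro p hp
    have hadj : (p.snd, -p.fst) ∈ g.adjoint := by
      rw [Submodule.mem_adjoint_iff]
      intro a b hab
      have := (Submodule.mem_orthogonal _ _).1 hp (WithLp.toLp 2 (a, b)) hab
      rw [WithLp.prod_inner_apply] at this
      simp only [inner_neg_right, sub_neg_eq_add]
      rw [add_comm]
      exact this
    have h := (Submodule.mem_adjoint_iff _ _).1 hx _ _ hadj
    simp only [inner_neg_left] at h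
    simp only [WithLp.prod_inner_apply, WithLp.ofLp_fst, WithLp.ofLp_snd]
    linear_combination -h
  · rw [Submodule.mem_adjoint_iff]
    intro b a hba
    have h := (Submodule.mem_adjoint_iff _ _).1 hba x.1 x.2 hx
    rw [sub_eq_zero] at h ⊢
    rw [← inner_conj_symm a, ← inner_conj_symm b, h]

namespace LinearPMap

variable {T : E →ₗ.[ℂ] F}

theorem IsClosed.dense_adjoint_domain (hdense : Dense (T.domain : Set E)) (hclosed : T.IsClosed) :
    Dense (T.adjoint.domain : Set F) := by
  rw [Submodule.dense_iff_topologicalClosure_eq_top, Submodule.topologicalClosure_eq_top_iff,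
    Submodule.eq_bot_iff]
  intro z hz
  have hmem : ((0 : E), z) ∈ T.graph.adjoint.adjoint := by
    rw [← adjoint_graph_eq_graph_adjoint hdense, Submodule.mem_adjoint_iff]
    intro b a hba
    rw [inner_zero_right, zero_sub, neg_eq_zero]
    exact (Submodule.mem_orthogonal _ _).1 hz b (mem_domain_of_mem_graph hba)
  rw [Submodule.adjoint_adjoint_of_isClosed _ hclosed] at hmem
  exact graph_fst_eq_zero_snd T hmem rfl

theorem IsClosed.adjoint_adjoint (hdense : Dense (T.domain : Set E)) (hclosed : T.IsClosed) :
    T.adjoint.adjoint = T := by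
  apply eq_of_eq_graph
  rw [adjoint_graph_eq_graph_adjoint (hclosed.dense_adjoint_domain hdense),
    adjoint_graph_eq_graph_adjoint hdense, Submodule.adjoint_adjoint_of_isClosed _ hclosed]

theorem IsClosed.isBoundedBelowOffKer (hclosed : T.IsClosed)
    (hrange : _root_.IsClosed {y : F | ∃ u : T.domain, T u = y}) : T.IsBoundedBelowOffKer := by
  let R : Submodule ℂ F := LinearMap.range T.toFun
  have hR : _root_.IsClosed (R : Set F) := hrange
  have : CompleteSpace R := hR.completeSpace_coe
  have : CompleteSpace T.graph := _root_.IsClosed.completeSpace_coe (hs := hclosed)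
  let f : T.graph →L[ℂ] R := ((ContinuousLinearMap.snd ℂ E F).comp T.graph.subtypeL).codRestrict R
    (by
      rintro ⟨x, hx⟩
      obtain ⟨u, -, hu⟩ := (mem_graph_iff T).1 hx
      exact ⟨u, hu⟩)
  have hf : Function.Surjective f := by
    rintro ⟨_, u, rfl⟩
    exact ⟨⟨_, T.mem_graph u⟩, rfl⟩
  obtain ⟨C, hC, h⟩ := f.exists_preimage_norm_le hf
  refine ⟨C, hC, fun u hu => ?_⟩
  obtain ⟨⟨x, hx⟩, hxu, hle⟩ := h ⟨T u, u, rfl⟩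
  obtain ⟨u', hu', hTu'⟩ := (mem_graph_iff T).1 hx
  have hx2 : x.2 = T u := congrArg Subtype.val hxu
  have hu'le : ‖(u' : E)‖ ≤ C * ‖T u‖ := by
    rw [hu']
    exact (norm_fst_le x).trans hle
  have horth : @inner ℂ _ _ (u : E) (u - u' : E) = 0 :=
    hu (u - u') (by rw [map_sub, hTu', hx2, sub_self])
  rw [inner_sub_right, sub_eq_zero] at horth
  refine le_trans ?_ hu'le
  have hsq : ‖(u : E)‖ * ‖(u : E)‖ ≤ ‖(u : E)‖ * ‖(u' : E)‖ := by
    rw [← inner_self_eq_norm_mul_norm (𝕜 := ℂ), horth]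
    exact re_inner_le_norm _ _
  rcases (norm_nonneg (u : E)).eq_or_lt' with h0 | h0
  · rw [h0]
    exact norm_nonneg _
  · exact le_of_mul_le_mul_left hsq h0

theorem IsBoundedBelowOffKer.isClosed_range (hclosed : T.IsClosed) (h : T.IsBoundedBelowOffKer) :
    _root_.IsClosed {y : F | ∃ u : T.domain, T u = y} := by
  obtain ⟨C, hC, h⟩ := h
  let N : Submodule ℂ E := T.graph.comap (LinearMap.inl ℂ E F)
  let S : Submodule ℂ (E × F) := T.graph ⊓ Nᗮ.comap (LinearMap.fst ℂ E F)
  have hS : _root_.IsClosed (S : Set (E × F)) :=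
    _root_.IsClosed.inter hclosed (N.isClosed_orthogonal.preimage continuous_fst)
  have : CompleteSpace S := hS.completeSpace_coe
  let f : S →L[ℂ] F := (ContinuousLinearMap.snd ℂ E F).comp S.subtypeL
  have hf : AntilipschitzWith (max C 1).toNNReal f := by
    refine AddMonoidHomClass.antilipschitz_of_bound f ?_
    rintro ⟨⟨x, y⟩, hx, hxN⟩
    obtain ⟨u, rfl, rfl⟩ := (mem_graph_iff T).1 hx
    have hu := h u fun w hw =>
      (Submodule.mem_orthogonal' _ _).1 hxN _ ((mem_graph_iff T).2 ⟨w, rfl, hw⟩)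
    rw [Real.coe_toNNReal _ (by positivity)]
    change max ‖(u : E)‖ ‖T u‖ ≤ max C 1 * ‖T u‖
    refine max_le (hu.trans ?_) (le_mul_of_one_le_left (norm_nonneg _) (le_max_right _ _))
    gcongr
    exact le_max_left _ _
  convert hf.isClosed_range f.uniformContinuous using 1
  ext y
  constructor
  · rintro ⟨u, rfl⟩
    obtain ⟨u', hu', horth⟩ := hclosed.exists_orthogonal_preimage u
    refine ⟨⟨(u', T u'), T.mem_graph u', (Submodule.mem_orthogonal' _ _).2 fun n hn => ?_⟩, hu'⟩
    obtain ⟨w, hw, hw0⟩ := (mem_graph_iff T).1 (show (n, (0 : F)) ∈ T.graph from hn)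
    exact (congrArg _ hw.symm).trans (horth w hw0)
  · rintro ⟨⟨x, hx, -⟩, rfl⟩
    obtain ⟨u, -, hu⟩ := (mem_graph_iff T).1 hx
    exact ⟨u, hu⟩

theorem IsClosed.isClosed_range_iff_isBoundedBelowOffKer (hclosed : T.IsClosed) :
    _root_.IsClosed {y : F | ∃ u : T.domain, T u = y} ↔ T.IsBoundedBelowOffKer :=
  ⟨hclosed.isBoundedBelowOffKer, fun h => h.isClosed_range hclosed⟩

theorem IsBoundedBelowOffKer.adjoint (hdense : Dense (T.domain : Set E)) (hclosed : T.IsClosed)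
    (h : T.IsBoundedBelowOffKer) : T.adjoint.IsBoundedBelowOffKer := by
  let R : Submodule ℂ F := LinearMap.range T.toFun
  have hR : _root_.IsClosed (R : Set F) := h.isClosed_range hclosed
  have : CompleteSpace R := hR.completeSpace_coe
  obtain ⟨C, hC, h⟩ := h
  refine ⟨C, hC, fun v hv => ?_⟩
  have hvR : (v : F) ∈ Rᗮᗮ := by
    refine (Submodule.mem_orthogonal' _ _).2 fun z hz => ?_
    have hz0 : ∀ x : T.domain, @inner ℂ _ _ (0 : E) (x : E) = @inner ℂ _ _ z (T x) := fun x => by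
      rw [inner_zero_left]
      exact ((Submodule.mem_orthogonal' _ _).1 hz _ ⟨x, rfl⟩).symm
    exact hv ⟨z, mem_adjoint_domain_of_exists z ⟨0, hz0⟩⟩ (adjoint_apply_eq hdense _ hz0)
  rw [Submodule.orthogonal_orthogonal] at hvR
  obtain ⟨u₀, hu₀⟩ := hvR
  obtain ⟨u, hu, horth⟩ := hclosed.exists_orthogonal_preimage u₀
  have huv : T u = v := hu.trans hu₀
  have hle : ‖(u : E)‖ ≤ C * ‖(v : F)‖ := huv ▸ h u horth
  have hsq : ‖(v : F)‖ * ‖(v : F)‖ ≤ ‖(v : F)‖ * (C * ‖T.adjoint v‖) := by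
    calc ‖(v : F)‖ * ‖(v : F)‖ = RCLike.re (@inner ℂ _ _ (T.adjoint v) (u : E)) := by
          rw [adjoint_isFormalAdjoint hdense v u, huv, inner_self_eq_norm_mul_norm]
      _ ≤ ‖T.adjoint v‖ * ‖(u : E)‖ := re_inner_le_norm _ _
      _ ≤ ‖T.adjoint v‖ * (C * ‖(v : F)‖) := by gcongr
      _ = _ := by ring
  rcases (norm_nonneg (v : F)).eq_or_lt' with h0 | h0
  · rw [h0]
    positivity
  · exact le_of_mul_le_mul_left hsq h0

theorem IsClosed.isBoundedBelowOffKer_adjoint_iff (hdense : Dense (T.domain : Set E))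
    (hclosed : T.IsClosed) : T.adjoint.IsBoundedBelowOffKer ↔ T.IsBoundedBelowOffKer := by
  refine ⟨fun h => ?_, fun h => h.adjoint hdense hclosed⟩
  have := h.adjoint (hclosed.dense_adjoint_domain hdense) (adjoint_isClosed hdense)
  rwa [hclosed.adjoint_adjoint hdense] at this

end LinearPMap

end ClosedRange


/-- **Closed range criterion.** Let `E`, `F` be complex Hilbert spaces and `T` a densely
defined, closed unbounded operator from `E` to `F`. Then the following are equivalent:
(i) the range of `T` is closed in `F`;
(ii) there is `C > 0` with `‖u‖ ≤ C‖Tu‖` for every `u ∈ D(T)` orthogonal to the kernel of `T`;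
(iii) there is `C > 0` with `‖v‖ ≤ C‖T*v‖` for every `v ∈ D(T*)` orthogonal to the kernel
of the adjoint `T*`. -/
theorem closed_range_tfae
    {E F : Type*} [NormedAddCommGroup E] [InnerProductSpace ℂ E] [CompleteSpace E]
    [NormedAddCommGroup F] [InnerProductSpace ℂ F] [CompleteSpace F]
    (T : E →ₗ.[ℂ] F) (hdense : Dense (T.domain : Set E)) (hclosed : T.IsClosed) :
    (IsClosed {y : F | ∃ u : T.domain, T u = y} ↔
      ∃ C > 0, ∀ u : T.domain,
        (∀ w : T.domain, T w = 0 → @inner ℂ _ _ (u : E) (w : E) = 0) →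
        ‖(u : E)‖ ≤ C * ‖T u‖) ∧
    (IsClosed {y : F | ∃ u : T.domain, T u = y} ↔
      ∃ C > 0, ∀ v : T.adjoint.domain,
        (∀ w : T.adjoint.domain, T.adjoint w = 0 → @inner ℂ _ _ (v : F) (w : F) = 0) →
        ‖(v : F)‖ ≤ C * ‖T.adjoint v‖) :=
  ⟨hclosed.isClosed_range_iff_isBoundedBelowOffKer,
    hclosed.isClosed_range_iff_isBoundedBelowOffKer.trans
      (hclosed.isBoundedBelowOffKer_adjoint_iff hdense).symm⟩
end

section
/- Let E and F be complex Hilbert spaces and let T be a densely defined, closed unbounded operator from E to F. Then the range R(T) is closed in F if and only if there exists a constant C > 0 such that for every v in the domain D(T*) of the adjoint, the distance from v to the kernel N(T*) satisfies dist(v, N(T*)) ≤ C‖T*v‖. -/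
open LinearPMap in
/-- A pair `(u, y)` with `⟪u, T* v⟫ = ⟪y, v⟫` for all `v ∈ D(T*)` lies in the graph of the densely
defined closed operator `T`; that is, `T** ≤ T`. -/
theorem LinearPMap.IsClosed.mem_graph_of_inner_adjoint_eq
    {𝕜 E F : Type*} [RCLike 𝕜] [NormedAddCommGroup E] [InnerProductSpace 𝕜 E] [CompleteSpace E]
    [NormedAddCommGroup F] [InnerProductSpace 𝕜 F] [CompleteSpace F]
    {T : E →ₗ.[𝕜] F} (hclosed : T.IsClosed) (hdense : Dense (T.domain : Set E)) {u : E} {y : F}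
    (h : ∀ v : T†.domain, inner 𝕜 u (T† v) = inner 𝕜 y (v : F)) : (u, y) ∈ T.graph := by
  let G : Submodule 𝕜 (WithLp 2 (E × F)) :=
    T.graph.comap (WithLp.linearEquiv 2 𝕜 (E × F)).toLinearMap
  have hG : _root_.IsClosed (G : Set (WithLp 2 (E × F))) :=
    _root_.IsClosed.preimage (WithLp.prod_continuous_ofLp 2 E F) hclosed
  have : CompleteSpace G := hG.completeSpace_coe
  suffices WithLp.toLp 2 (u, y) ∈ G from this
  rw [← G.orthogonal_orthogonal, Submodule.mem_orthogonal']
  intro p hp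
  obtain ⟨a, b⟩ := p
  rw [Submodule.mem_orthogonal'] at hp
  have hab (x : T.domain) : inner 𝕜 (-a) (x : E) = inner 𝕜 b (T x) := by
    have := hp (WithLp.toLp 2 ((x : E), T x)) (T.mem_graph x)
    simp only [WithLp.prod_inner_apply] at this
    rw [inner_neg_left, neg_eq_iff_add_eq_zero]
    exact this
  have hb : b ∈ T†.domain := mem_adjoint_domain_of_exists b ⟨-a, hab⟩
  have hTb : T† ⟨b, hb⟩ = -a := adjoint_apply_eq hdense ⟨b, hb⟩ hab
  have := h ⟨b, hb⟩
  rw [hTb, inner_neg_right, neg_eq_iff_add_eq_zero] at this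
  simpa only [WithLp.prod_inner_apply] using this

open LinearPMap in
/-- The kernel of the adjoint is the orthogonal complement of the range. -/
theorem LinearPMap.mem_ker_adjoint_iff_mem_orthogonal_range
    {𝕜 E F : Type*} [RCLike 𝕜] [NormedAddCommGroup E] [InnerProductSpace 𝕜 E] [CompleteSpace E]
    [NormedAddCommGroup F] [InnerProductSpace 𝕜 F]
    {T : E →ₗ.[𝕜] F} (hdense : Dense (T.domain : Set E)) (w : F) :
    (∃ hw : w ∈ T†.domain, T† ⟨w, hw⟩ = 0) ↔ w ∈ (LinearMap.range T.toFun)ᗮ := by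
  rw [Submodule.mem_orthogonal']
  constructor
  · rintro ⟨hw, h⟩ _ ⟨x, rfl⟩
    have := adjoint_isFormalAdjoint hdense ⟨w, hw⟩ x
    rw [h, inner_zero_left] at this
    exact this.symm
  · intro h
    have h0 (x : T.domain) : inner 𝕜 (0 : E) (x : E) = inner 𝕜 w (T x) := by
      rw [inner_zero_left]
      exact (h _ ⟨x, rfl⟩).symm
    have hw : w ∈ T†.domain := mem_adjoint_domain_of_exists w ⟨0, h0⟩
    exact ⟨hw, adjoint_apply_eq hdense ⟨w, hw⟩ h0⟩

/-- A closed operator with closed range between Banach spaces has a bounded choice of preimages. -/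
theorem LinearPMap.IsClosed.exists_preimage_norm_le
    {𝕜 E F : Type*} [NontriviallyNormedField 𝕜] [NormedAddCommGroup E] [NormedSpace 𝕜 E]
    [CompleteSpace E] [NormedAddCommGroup F] [NormedSpace 𝕜 F] [CompleteSpace F]
    {T : E →ₗ.[𝕜] F} (hclosed : T.IsClosed)
    (hrange : _root_.IsClosed (LinearMap.range T.toFun : Set F)) :
    ∃ C > 0, ∀ y ∈ LinearMap.range T.toFun, ∃ u : T.domain, T u = y ∧ ‖(u : E)‖ ≤ C * ‖y‖ := by
  have : CompleteSpace T.graph :=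
    have h : _root_.IsClosed (T.graph : Set (E × F)) := hclosed
    h.completeSpace_coe
  have : CompleteSpace (LinearMap.range T.toFun) := hrange.completeSpace_coe
  have hmem (p : T.graph) : (p : E × F).2 ∈ LinearMap.range T.toFun := by
    obtain ⟨x, -, hx⟩ := (T.mem_graph_iff).1 p.2
    exact ⟨x, hx⟩
  let S : T.graph →L[𝕜] LinearMap.range T.toFun :=
    ((ContinuousLinearMap.snd 𝕜 E F).comp T.graph.subtypeL).codRestrict _ hmem
  have hS : Function.Surjective S := by
    rintro ⟨_, x, rfl⟩
    exact ⟨⟨((x : E), T x), T.mem_graph x⟩, rfl⟩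
  obtain ⟨C, hC, h⟩ := S.exists_preimage_norm_le hS
  refine ⟨C, hC, fun y hy => ?_⟩
  obtain ⟨p, hp, hle⟩ := h ⟨y, hy⟩
  obtain ⟨x, hx1, hx2⟩ := (T.mem_graph_iff).1 p.2
  have hpy : (p : E × F).2 = y := congrArg Subtype.val hp
  refine ⟨x, hx2.trans hpy, ?_⟩
  rw [hx1]
  exact (norm_fst_le (p : E × F)).trans hle

/-- A linear functional `f` dominated by `‖A ·‖` is of the form `⟪u, A ·⟫`. -/
theorem LinearMap.exists_inner_eq_of_norm_le
    {𝕜 V E : Type*} [RCLike 𝕜] [AddCommGroup V] [Module 𝕜 V]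
    [NormedAddCommGroup E] [InnerProductSpace 𝕜 E] [CompleteSpace E]
    (A : V →ₗ[𝕜] E) (f : V →ₗ[𝕜] 𝕜) {C : ℝ} (h : ∀ v, ‖f v‖ ≤ C * ‖A v‖) :
    ∃ u : E, ∀ v, inner 𝕜 u (A v) = f v := by
  have hf : f ∈ LinearMap.range A.dualMap := by
    rw [LinearMap.range_dualMap_eq_dualAnnihilator_ker, Submodule.mem_dualAnnihilator]
    intro v hv
    rw [← norm_le_zero_iff]
    simpa [LinearMap.mem_ker.1 hv] using h v
  obtain ⟨g, rfl⟩ := hf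
  let g₀ : StrongDual 𝕜 (LinearMap.range A) :=
    (g.domRestrict (LinearMap.range A)).mkContinuous C (by
      rintro ⟨_, v, rfl⟩
      exact h v)
  obtain ⟨G, hG, -⟩ := exists_extension_norm_eq (LinearMap.range A) g₀
  refine ⟨(InnerProductSpace.toDual 𝕜 E).symm G, fun v => ?_⟩
  rw [InnerProductSpace.toDual_symm_apply]
  exact hG ⟨A v, v, rfl⟩

/-- A vector orthogonal to `K` pairs with `v` by at most its norm times the distance of `v`
to `K`. -/
theorem Submodule.norm_inner_le_norm_mul_infDist
    {𝕜 F : Type*} [RCLike 𝕜] [NormedAddCommGroup F] [InnerProductSpace 𝕜 F]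
    {K : Submodule 𝕜 F} {y : F} (hy : y ∈ Kᗮ) (v : F) :
    ‖inner 𝕜 y v‖ ≤ ‖y‖ * Metric.infDist v (K : Set F) := by
  rcases (norm_nonneg y).eq_or_lt with h0 | h0
  · simp [norm_eq_zero.1 h0.symm]
  rw [← div_le_iff₀' h0, Metric.le_infDist ⟨0, K.zero_mem⟩]
  intro w hw
  rw [div_le_iff₀' h0, dist_eq_norm]
  have : inner 𝕜 y v = inner 𝕜 y (v - w) := by
    rw [inner_sub_right, (K.mem_orthogonal' y).1 hy w hw, sub_zero]
  rw [this]
  exact norm_inner_le_norm y (v - w)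

/-- Let `E`, `F` be complex Hilbert spaces and `T` a densely defined, closed unbounded
operator from `E` to `F`. Then the range of `T` is closed in `F` if and only if there is a
constant `C > 0` such that for every `v` in the domain of the adjoint `T*`,
`dist(v, N(T*)) ≤ C‖T*v‖`, where `N(T*)` is the kernel of `T*`. -/
theorem closed_range_iff_dist_kernel_adjoint
    {E F : Type*} [NormedAddCommGroup E] [InnerProductSpace ℂ E] [CompleteSpace E]
    [NormedAddCommGroup F] [InnerProductSpace ℂ F] [CompleteSpace F]
    (T : E →ₗ.[ℂ] F) (hdense : Dense (T.domain : Set E)) (hclosed : T.IsClosed) :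
    IsClosed {y : F | ∃ u : T.domain, T u = y} ↔
      ∃ C > 0, ∀ v : T.adjoint.domain,
        Metric.infDist (v : F)
            {w : F | ∃ hw : w ∈ T.adjoint.domain, T.adjoint ⟨w, hw⟩ = 0}
          ≤ C * ‖T.adjoint v‖ := by
  have hker : {w : F | ∃ hw : w ∈ T.adjoint.domain, T.adjoint ⟨w, hw⟩ = 0} =
      ((LinearMap.range T.toFun)ᗮ : Submodule ℂ F) :=
    Set.ext (LinearPMap.mem_ker_adjoint_iff_mem_orthogonal_range hdense)
  have hran : {y : F | ∃ u : T.domain, T u = y} = (LinearMap.range T.toFun : Set F) := rfl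
  rw [hker, hran]
  constructor
  · intro hR
    obtain ⟨C, hC, hpre⟩ := hclosed.exists_preimage_norm_le hR
    have : CompleteSpace (LinearMap.range T.toFun) := hR.completeSpace_coe
    refine ⟨C, hC, fun v => ?_⟩
    obtain ⟨w, hw, n, hn, hv⟩ := (LinearMap.range T.toFun).exists_add_mem_mem_orthogonal (v : F)
    refine (Metric.infDist_le_dist_of_mem hn).trans ?_
    rw [hv, dist_eq_norm, add_sub_cancel_right]
    obtain ⟨u, hu, hle⟩ := hpre w hw
    have hinner : inner ℂ w w = inner ℂ (u : E) (T.adjoint v) := by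
      rw [← (LinearPMap.adjoint_isFormalAdjoint hdense).symm u v, hu, hv, inner_add_right,
        (Submodule.mem_orthogonal _ n).1 hn w hw, add_zero]
    have hsq : ‖w‖ * ‖w‖ ≤ C * ‖w‖ * ‖T.adjoint v‖ := by
      rw [← inner_self_eq_norm_mul_norm (𝕜 := ℂ) w, hinner]
      exact (re_inner_le_norm _ _).trans (by gcongr)
    rcases (norm_nonneg w).eq_or_lt with h0 | h0
    · rw [← h0]
      positivity
    · exact le_of_mul_le_mul_left (by linarith) h0
  · rintro ⟨C, -, hC⟩
    refine isClosed_of_closure_subset fun y hy => ?_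
    rw [← Submodule.topologicalClosure_coe, ← Submodule.orthogonal_orthogonal_eq_closure] at hy
    obtain ⟨u, hu⟩ := LinearMap.exists_inner_eq_of_norm_le T.adjoint.toFun
      ((innerₛₗ ℂ y).comp T.adjoint.domain.subtype) (C := ‖y‖ * C) fun v => by
        rw [mul_assoc]
        exact (Submodule.norm_inner_le_norm_mul_infDist hy (v : F)).trans
          (mul_le_mul_of_nonneg_left (hC v) (norm_nonneg y))
    obtain ⟨x, -, hx⟩ := (T.mem_graph_iff).1 (hclosed.mem_graph_of_inner_adjoint_eq hdense hu)
    exact ⟨x, hx⟩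
end

section
/- Let H₀, H, H₁ be complex Hilbert spaces, T a densely defined closed unbounded operator from H₀ to H, and S a densely defined closed unbounded operator from H to H₁. Suppose there is a bounded linear operator N : H → H such that for every α ∈ H one has Nα ∈ D(S) ∩ D(T*), S(Nα) ∈ D(S*), T*(Nα) ∈ D(T), and T(T*(Nα)) + S*(S(Nα)) = α. Then for every u ∈ D(S) ∩ D(T*) one has ‖u‖ ≤ √(‖N‖op) · (‖Su‖ + ‖T*u‖); in particular there is a constant C > 0 such that ‖u‖ ≤ C(‖Su‖ + ‖T*u‖) for all u ∈ D(S) ∩ D(T*). -/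
/-- Green's formula for the abstract complex Laplacian `T T* + S* S`. -/
theorem inner_laplacian_eq
    {H₀ H H₁ : Type*}
    [NormedAddCommGroup H₀] [InnerProductSpace ℂ H₀] [CompleteSpace H₀]
    [NormedAddCommGroup H] [InnerProductSpace ℂ H] [CompleteSpace H]
    [NormedAddCommGroup H₁] [InnerProductSpace ℂ H₁]
    (T : H₀ →ₗ.[ℂ] H) (S : H →ₗ.[ℂ] H₁)
    (hT : Dense (T.domain : Set H₀)) (hS : Dense (S.domain : Set H))
    {v w : H} (hv1 : v ∈ S.domain) (hv2 : v ∈ T.adjoint.domain)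
    (h3 : S ⟨v, hv1⟩ ∈ S.adjoint.domain) (h4 : T.adjoint ⟨v, hv2⟩ ∈ T.domain)
    (hw1 : w ∈ S.domain) (hw2 : w ∈ T.adjoint.domain) :
    inner ℂ (T ⟨T.adjoint ⟨v, hv2⟩, h4⟩ + S.adjoint ⟨S ⟨v, hv1⟩, h3⟩) w =
      inner ℂ (T.adjoint ⟨v, hv2⟩) (T.adjoint ⟨w, hw2⟩) +
        inner ℂ (S ⟨v, hv1⟩) (S ⟨w, hw1⟩) := by
  rw [inner_add_left]
  congr 1
  · exact (LinearPMap.adjoint_isFormalAdjoint hT).symm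
      ⟨T.adjoint ⟨v, hv2⟩, h4⟩ ⟨w, hw2⟩
  · exact LinearPMap.adjoint_isFormalAdjoint hS ⟨S ⟨v, hv1⟩, h3⟩ ⟨w, hw1⟩


/-- Let `H₀, H, H₁` be complex Hilbert spaces, `T` a densely defined closed unbounded operator
from `H₀` to `H`, and `S` a densely defined closed unbounded operator from `H` to `H₁`.
If `N : H → H` is a bounded operator inverting the Laplacian `□ = T T* + S* S`, i.e. for every
`α ∈ H` one has `Nα ∈ D(S) ∩ D(T*)`, `S(Nα) ∈ D(S*)`, `T*(Nα) ∈ D(T)`, and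
`T(T*(Nα)) + S*(S(Nα)) = α`, then `‖u‖ ≤ √‖N‖·(‖Su‖ + ‖T*u‖)` for all `u ∈ D(S) ∩ D(T*)`;
in particular there is `C > 0` with `‖u‖ ≤ C(‖Su‖ + ‖T*u‖)` on `D(S) ∩ D(T*)`. -/
theorem basic_estimate_of_bounded_neumann
    {H₀ H H₁ : Type*}
    [NormedAddCommGroup H₀] [InnerProductSpace ℂ H₀] [CompleteSpace H₀]
    [NormedAddCommGroup H] [InnerProductSpace ℂ H] [CompleteSpace H]
    [NormedAddCommGroup H₁] [InnerProductSpace ℂ H₁] [CompleteSpace H₁]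
    (T : H₀ →ₗ.[ℂ] H) (S : H →ₗ.[ℂ] H₁)
    (hTdense : Dense (T.domain : Set H₀)) (hTclosed : T.IsClosed)
    (hSdense : Dense (S.domain : Set H)) (hSclosed : S.IsClosed)
    (N : H →L[ℂ] H)
    (hN : ∀ α : H, ∃ (h1 : N α ∈ S.domain) (h2 : N α ∈ T.adjoint.domain)
        (h3 : S ⟨N α, h1⟩ ∈ S.adjoint.domain) (h4 : T.adjoint ⟨N α, h2⟩ ∈ T.domain),
        T ⟨T.adjoint ⟨N α, h2⟩, h4⟩ + S.adjoint ⟨S ⟨N α, h1⟩, h3⟩ = α) :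
    (∀ u : H, ∀ (hu1 : u ∈ S.domain) (hu2 : u ∈ T.adjoint.domain),
        ‖u‖ ≤ Real.sqrt ‖N‖ * (‖S ⟨u, hu1⟩‖ + ‖T.adjoint ⟨u, hu2⟩‖)) ∧
      ∃ C > 0, ∀ u : H, ∀ (hu1 : u ∈ S.domain) (hu2 : u ∈ T.adjoint.domain),
        ‖u‖ ≤ C * (‖S ⟨u, hu1⟩‖ + ‖T.adjoint ⟨u, hu2⟩‖) := by
  have estimate : ∀ u : H, ∀ (hu1 : u ∈ S.domain) (hu2 : u ∈ T.adjoint.domain),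
      ‖u‖ ≤ Real.sqrt ‖N‖ * (‖S ⟨u, hu1⟩‖ + ‖T.adjoint ⟨u, hu2⟩‖) := by
    intro u hu1 hu2
    obtain ⟨h1, h2, h3, h4, h⟩ := hN u
    have hu := inner_laplacian_eq T S hTdense hSdense h1 h2 h3 h4 hu1 hu2
    have hNu := inner_laplacian_eq T S hTdense hSdense h1 h2 h3 h4 h1 h2
    rw [h] at hu hNu
    set a := T.adjoint ⟨N u, h2⟩
    set b := S ⟨N u, h1⟩
    set c := T.adjoint ⟨u, hu2⟩
    set d := S ⟨u, hu1⟩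
    have energy : ‖a‖ ^ 2 + ‖b‖ ^ 2 ≤ ‖N‖ * ‖u‖ ^ 2 := by
      calc ‖a‖ ^ 2 + ‖b‖ ^ 2 = RCLike.re (inner ℂ u (N u)) := by
            rw [hNu, map_add, inner_self_eq_norm_sq, inner_self_eq_norm_sq]
        _ ≤ ‖u‖ * ‖N u‖ := re_inner_le_norm _ _
        _ ≤ ‖u‖ * (‖N‖ * ‖u‖) := by gcongr; exact N.le_opNorm u
        _ = ‖N‖ * ‖u‖ ^ 2 := by ring
    have hsqrt : Real.sqrt (‖N‖ * ‖u‖ ^ 2) = Real.sqrt ‖N‖ * ‖u‖ := by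
      rw [Real.sqrt_mul (norm_nonneg _), Real.sqrt_sq (norm_nonneg _)]
    have ha : ‖a‖ ≤ Real.sqrt ‖N‖ * ‖u‖ :=
      hsqrt ▸ Real.le_sqrt_of_sq_le (by linarith [sq_nonneg ‖b‖])
    have hb : ‖b‖ ≤ Real.sqrt ‖N‖ * ‖u‖ :=
      hsqrt ▸ Real.le_sqrt_of_sq_le (by linarith [sq_nonneg ‖a‖])
    have key : ‖u‖ * ‖u‖ ≤ ‖u‖ * (Real.sqrt ‖N‖ * (‖d‖ + ‖c‖)) := by
      calc ‖u‖ * ‖u‖ = RCLike.re (inner ℂ u u) := (inner_self_eq_norm_mul_norm u).symm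
        _ = RCLike.re (inner ℂ a c) + RCLike.re (inner ℂ b d) := by rw [hu, map_add]
        _ ≤ ‖a‖ * ‖c‖ + ‖b‖ * ‖d‖ :=
          add_le_add (re_inner_le_norm _ _) (re_inner_le_norm _ _)
        _ ≤ (Real.sqrt ‖N‖ * ‖u‖) * ‖c‖ + (Real.sqrt ‖N‖ * ‖u‖) * ‖d‖ := by gcongr
        _ = ‖u‖ * (Real.sqrt ‖N‖ * (‖d‖ + ‖c‖)) := by ring
    rcases (norm_nonneg u).eq_or_lt with h0 | hpos
    · rw [← h0]
      positivity
    · exact le_of_mul_le_mul_left key hpos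
  refine ⟨estimate, Real.sqrt ‖N‖ + 1, by positivity, fun u hu1 hu2 => ?_⟩
  refine (estimate u hu1 hu2).trans ?_
  gcongr
  linarith
end
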